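/- Suppose the action of G_A on Y is regular and ω ∈ Ω̂ is an r-homogeneous sequence (r ≥ 3). Then the period growth function of the spinal group G_ω satisfies π_ω(n) ≾ n^{log_{1/η_r}(q)}, where η_r is the unique root in (0,1) of the polynomial x^r + x^{r−1} + x^{r−2} − 2. -/

import Mathlib

noncomputable section

open Equiv

namespace Spinal

/-- The letter `q` of the alphabet `{1,…,q}` (here `q = m + 2`). -/
def qtop (m : ℕ) : Fin (m + 2) := Fin.last (m + 1)

/-- The letter `1` of the alphabet. -/
def qone (m : ℕ) : Fin (m + 2) := 0


theorem qone_ne_qtop (m : ℕ) : qone m ≠ qtop m := by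
  simp [qone, qtop, Fin.ext_iff]

/-- The action of an alphabet permutation on the first letter of a word. -/
def rootFun (m : ℕ) (a : Equiv.Perm (Fin (m + 2))) :
    List (Fin (m + 2)) → List (Fin (m + 2))
  | [] => []
  | y :: w => a y :: w

theorem rootFun_leftInv (m : ℕ) (a : Equiv.Perm (Fin (m + 2))) (w : List (Fin (m + 2))) :
    rootFun m a.symm (rootFun m a w) = w := by
  cases w <;> simp [rootFun]

/-- The tree automorphism induced by a root permutation. -/
def rootAut (m : ℕ) (a : Equiv.Perm (Fin (m + 2))) : Equiv.Perm (List (Fin (m + 2))) where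
  toFun := rootFun m a
  invFun := rootFun m a.symm
  left_inv w := rootFun_leftInv m a w
  right_inv w := by simpa using rootFun_leftInv m a.symm w

variable {GB : Type*} [Group GB]

/-- The spinal action of `b : G_B` determined by the sequence `ω` of homomorphisms:
at the vertex `q^n 1` the next letter is moved by `ω n b` (0-indexed, so `ω 0` is the
paper's `ω₁`). -/
def spinalFun (m : ℕ) (ω : ℕ → GB →* Equiv.Perm (Fin (m + 2))) (b : GB) :
    ℕ → List (Fin (m + 2)) → List (Fin (m + 2))
  | _, [] => []
  | n, y :: w =>
    if y = qtop m then y :: spinalFun m ω b (n + 1) w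
    else if y = qone m then
      y :: (match w with
            | [] => []
            | z :: w' => ω n b z :: w')
    else y :: w

theorem spinalFun_leftInv (m : ℕ) (ω : ℕ → GB →* Equiv.Perm (Fin (m + 2)))
    (b : GB) (n : ℕ) (w : List (Fin (m + 2))) :
    spinalFun m ω b⁻¹ n (spinalFun m ω b n w) = w := by
  induction w generalizing n with
  | nil => simp [spinalFun]
  | cons y w ih =>
    by_cases h1 : y = qtop m
    · simp [spinalFun, h1, ih]
    · by_cases h2 : y = qone m
      · match w with
        | [] => simp [spinalFun, h1, h2]
        | z :: w' => simp [spinalFun, h1, h2, map_inv, qone_ne_qtop]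
      · simp [spinalFun, h1, h2]

/-- The tree automorphism induced by `b : G_B` via the sequence `ω`. -/
def spinalAut (m : ℕ) (ω : ℕ → GB →* Equiv.Perm (Fin (m + 2))) (b : GB) :
    Equiv.Perm (List (Fin (m + 2))) where
  toFun := spinalFun m ω b 0
  invFun := spinalFun m ω b⁻¹ 0
  left_inv w := spinalFun_leftInv m ω b 0 w
  right_inv w := by simpa using spinalFun_leftInv m ω b⁻¹ 0 w

/-- The canonical generating set `S_ω = A ∪ B_ω` (non-identity induced automorphisms). -/
def genSet (m : ℕ) (GA : Subgroup (Equiv.Perm (Fin (m + 2))))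
    (ω : ℕ → GB →* Equiv.Perm (Fin (m + 2))) : Set (Equiv.Perm (List (Fin (m + 2)))) :=
  ((rootAut m '' (GA : Set (Equiv.Perm (Fin (m + 2))))) ∪
    Set.range fun b : GB => spinalAut m ω b) \ {1}

/-- The spinal group `G_ω`, as a subgroup of the permutation group of the vertex set
of the `(m+2)`-regular rooted tree. -/
def spinalGroup (m : ℕ) (GA : Subgroup (Equiv.Perm (Fin (m + 2))))
    (ω : ℕ → GB →* Equiv.Perm (Fin (m + 2))) : Subgroup (Equiv.Perm (List (Fin (m + 2)))) :=
  Subgroup.closure (genSet m GA ω)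

/-- The defining conditions on the data `(G_A, G_B, ω)` of a spinal group:
`G_A` is a transitive (hence faithful) group of permutations of the alphabet,
every `ω n` is an epimorphism onto `G_A`, and `ω ∈ Ω̂`: from every index on, the kernels
of the remaining homomorphisms cover `G_B` and intersect trivially. -/
structure SpinalData (m : ℕ) (GA : Subgroup (Equiv.Perm (Fin (m + 2))))
    (ω : ℕ → GB →* Equiv.Perm (Fin (m + 2))) : Prop where
  transitive : ∀ i j : Fin (m + 2), ∃ a ∈ GA, a i = j
  range_eq : ∀ n, (ω n).range = GA
  kernels_cover : ∀ i : ℕ, ∀ b : GB, ∃ j, i ≤ j ∧ ω j b = 1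
  kernels_sep : ∀ i : ℕ, ∀ b : GB, (∀ j, i ≤ j → ω j b = 1) → b = 1

/-- Word length of a group element with respect to a set of generators. -/
def wordLength {G : Type*} [Group G] (S : Set G) (g : G) : ℕ :=
  sInf {n | ∃ l : List G, l.length = n ∧ (∀ x ∈ l, x ∈ S) ∧ l.prod = g}

/-- The word growth function `γ_ω` of the spinal group with respect to `S_ω`. -/
def growth (m : ℕ) (GA : Subgroup (Equiv.Perm (Fin (m + 2))))
    (ω : ℕ → GB →* Equiv.Perm (Fin (m + 2))) (n : ℕ) : ℕ :=
  Nat.card {g : Equiv.Perm (List (Fin (m + 2))) //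
    g ∈ spinalGroup m GA ω ∧ wordLength (genSet m GA ω) g ≤ n}

/-- The period growth function `π_ω`: the largest order of an element of word length
at most `n`. -/
def periodGrowth (m : ℕ) (GA : Subgroup (Equiv.Perm (Fin (m + 2))))
    (ω : ℕ → GB →* Equiv.Perm (Fin (m + 2))) (n : ℕ) : ℕ :=
  sSup (orderOf '' {g : Equiv.Perm (List (Fin (m + 2))) |
    g ∈ spinalGroup m GA ω ∧ wordLength (genSet m GA ω) g ≤ n})

/-- Abstract letters for words over `S_ω`: an `A`-letter is (induced by) a permutation
of the alphabet, a `B`-letter is (induced by) an element of `G_B`. -/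
abbrev Letter (m : ℕ) (GB : Type*) := Equiv.Perm (Fin (m + 2)) ⊕ GB

/-- Evaluation of an abstract letter as a tree automorphism. -/
def evalLetter (m : ℕ) (ω : ℕ → GB →* Equiv.Perm (Fin (m + 2))) :
    Letter m GB → Equiv.Perm (List (Fin (m + 2))) :=
  Sum.elim (rootAut m) (spinalAut m ω)

/-- The list of `A`-letters of a word, in order. -/
def aLetters {m : ℕ} {GB : Type*} : List (Letter m GB) → List (Equiv.Perm (Fin (m + 2))) :=
  List.filterMap fun x => match x with
    | Sum.inl a => some a
    | Sum.inr _ => none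

/-- The list of `B`-letters of a word, in order. -/
def bLetters {m : ℕ} {GB : Type*} : List (Letter m GB) → List GB :=
  List.filterMap fun x => match x with
    | Sum.inl _ => none
    | Sum.inr b => some b

/-- A word is reduced if its letters alternate between `A`-letters and `B`-letters and
no letter is the identity. -/
def IsReduced {m : ℕ} (F : List (Letter m GB)) : Prop :=
  List.Chain' (fun x y => x.isLeft ≠ y.isLeft) F ∧
    Sum.inl (1 : Equiv.Perm (Fin (m + 2))) ∉ F ∧ Sum.inr (1 : GB) ∉ F

open scoped Classical in
/-- One step of the (complete, confluent) simple reduction process: prepend a letter to an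
already reduced word and reduce. -/
def reduceStep {m : ℕ} : Letter m GB → List (Letter m GB) → List (Letter m GB)
  | Sum.inl a, [] => if a = 1 then [] else [Sum.inl a]
  | Sum.inr b, [] => if b = 1 then [] else [Sum.inr b]
  | Sum.inl a, Sum.inl a' :: t => if a * a' = 1 then t else Sum.inl (a * a') :: t
  | Sum.inr b, Sum.inr b' :: t => if b * b' = 1 then t else Sum.inr (b * b') :: t
  | Sum.inl a, y :: t => if a = 1 then y :: t else Sum.inl a :: y :: t
  | Sum.inr b, y :: t => if b = 1 then y :: t else Sum.inr b :: y :: t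

/-- The reduced form of a word, obtained by simple reductions. -/
def reduceWord {m : ℕ} (F : List (Letter m GB)) : List (Letter m GB) :=
  F.foldr reduceStep []

open scoped Classical in
/-- The (unreduced) projection of a word, representing an element of the first-level
stabilizer, to the coordinate `i` of the first level: scanning the word from the left
while accumulating the product `g` of the `A`-letters, a `B`-letter `b` contributes the
letter `b` at the coordinate `g(q)` and the letter `ω₁(b)` at the coordinate `g(1)`. -/
def projWord (m : ℕ) (ω0 : GB →* Equiv.Perm (Fin (m + 2))) (i : Fin (m + 2)) :
    List (Letter m GB) → Equiv.Perm (Fin (m + 2)) → List (Letter m GB)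
  | [], _ => []
  | Sum.inl a :: F, g => projWord m ω0 i F (g * a)
  | Sum.inr b :: F, g =>
      ((if g (qtop m) = i then [Sum.inr b] else []) ++
        (if g (qone m) = i then [Sum.inl (ω0 b)] else [])) ++ projWord m ω0 i F g

/-- The list of the `q^r` (reduced) words at level `r` of the depth-`r` decomposition
of a word. -/
def levelWords (m : ℕ) :
    (ℕ → GB →* Equiv.Perm (Fin (m + 2))) → ℕ → List (Letter m GB) →
      List (List (Letter m GB))
  | _, 0, F => [F]
  | ω, r + 1, F =>
      (List.finRange (m + 2)).flatMap fun i =>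
        levelWords m (fun n => ω (n + 1)) r (reduceWord (projWord m (ω 0) i F 1))

/-- `|L_r(F)|`: the total length of level `r` of the depth-`r` decomposition of `F`. -/
def levelLength (m : ℕ) (ω : ℕ → GB →* Equiv.Perm (Fin (m + 2))) (r : ℕ)
    (F : List (Letter m GB)) : ℕ :=
  ((levelWords m ω r F).map List.length).sum

/-- The triangular weight of a letter: `A`-letters have weight `τ₀ = 1 - η^r`; a
`B`-letter `b` has weight `τ_i = η^r + η^(r-i) - 1` where `i` is the smallest (1-based)
index with `ω_i(b) = 1`. -/
def letterWeight (m : ℕ) (ω : ℕ → GB →* Equiv.Perm (Fin (m + 2))) (η : ℝ) (r : ℕ) :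
    Letter m GB → ℝ
  | Sum.inl _ => 1 - η ^ r
  | Sum.inr b => η ^ r + η ^ (r - (sInf {j | ω j b = 1} + 1)) - 1

/-- The total triangular weight of a word. -/
def wordWeight (m : ℕ) (ω : ℕ → GB →* Equiv.Perm (Fin (m + 2))) (η : ℝ) (r : ℕ)
    (F : List (Letter m GB)) : ℝ :=
  (F.map (letterWeight m ω η r)).sum

/-- The weight `∂^τ(g)` of a group element: the least total weight of a word over `S_ω`
representing it. -/
def elemWeight (m : ℕ) (GA : Subgroup (Equiv.Perm (Fin (m + 2))))
    (ω : ℕ → GB →* Equiv.Perm (Fin (m + 2))) (η : ℝ) (r : ℕ)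
    (g : Equiv.Perm (List (Fin (m + 2)))) : ℝ :=
  sInf {x : ℝ | ∃ F : List (Letter m GB),
    (∀ a : Equiv.Perm (Fin (m + 2)), Sum.inl a ∈ F → a ∈ GA) ∧
    (F.map (evalLetter m ω)).prod = g ∧ wordWeight m ω η r F = x}

theorem spinalFun_mul (m : ℕ) (ω : ℕ → GB →* Equiv.Perm (Fin (m + 2))) (b c : GB) (n : ℕ)
    (w : List (Fin (m + 2))) :
    spinalFun m ω (b * c) n w = spinalFun m ω b n (spinalFun m ω c n w) := by
  induction w generalizing n with
  | nil => simp [spinalFun]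
  | cons y w ih =>
    by_cases h1 : y = qtop m
    · simp [spinalFun, h1, ih]
    · by_cases h2 : y = qone m
      · match w with
        | [] => simp [spinalFun, h2]
        | z :: w' => simp [spinalFun, h2, qone_ne_qtop]
      · simp [spinalFun, h1, h2]

theorem spinalFun_succ (m : ℕ) (ω : ℕ → GB →* Equiv.Perm (Fin (m + 2))) (b : GB) (n : ℕ)
    (w : List (Fin (m + 2))) :
    spinalFun m ω b (n + 1) w = spinalFun m (fun k => ω (k + 1)) b n w := by
  induction w generalizing n with
  | nil => simp [spinalFun]
  | cons y w ih => simp only [spinalFun, ih]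

/-- The embedding of the alphabet permutations as rooted automorphisms, as a homomorphism. -/
def rootHom (m : ℕ) : Equiv.Perm (Fin (m + 2)) →* Equiv.Perm (List (Fin (m + 2))) :=
  MonoidHom.mk' (rootAut m) fun a b => by
    ext1 w
    cases w <;> rfl

/-- The spinal action of the level group, as a homomorphism. -/
def spinalHom (m : ℕ) (ω : ℕ → GB →* Equiv.Perm (Fin (m + 2))) :
    GB →* Equiv.Perm (List (Fin (m + 2))) :=
  MonoidHom.mk' (spinalAut m ω) fun b c => by
    ext1 w
    exact spinalFun_mul m ω b c 0 w

/-- `g` fixes the root, acts on the first level as `π`, and has section `h y` at the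
first-level vertex `y`. -/
structure HasSections {m : ℕ} (g : Equiv.Perm (List (Fin (m + 2))))
    (π : Equiv.Perm (Fin (m + 2))) (h : Fin (m + 2) → Equiv.Perm (List (Fin (m + 2)))) :
    Prop where
  nil : g [] = []
  cons : ∀ y w, g (y :: w) = π y :: h y w

namespace HasSections

variable {m : ℕ} {g g' : Equiv.Perm (List (Fin (m + 2)))} {π π' : Equiv.Perm (Fin (m + 2))}
  {h h' : Fin (m + 2) → Equiv.Perm (List (Fin (m + 2)))}

theorem one : HasSections (1 : Equiv.Perm (List (Fin (m + 2)))) 1 fun _ => 1 :=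
  ⟨rfl, fun _ _ => rfl⟩

theorem mul (hg : HasSections g π h) (hg' : HasSections g' π' h') :
    HasSections (g * g') (π * π') fun y => h (π' y) * h' y :=
  ⟨by simp [hg.nil, hg'.nil], fun y w => by simp [hg.cons, hg'.cons]⟩

theorem rootHom (a : Equiv.Perm (Fin (m + 2))) :
    HasSections (Spinal.rootHom m a) a fun _ => 1 :=
  ⟨rfl, fun _ _ => rfl⟩

theorem spinalHom (ω : ℕ → GB →* Equiv.Perm (Fin (m + 2))) (b : GB) :
    HasSections (Spinal.spinalHom m ω b) 1 fun y =>
      (if y = qtop m then Spinal.spinalHom m (fun n => ω (n + 1)) b else 1) *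
        (if y = qone m then Spinal.rootHom m (ω 0 b) else 1) := by
  refine ⟨rfl, fun y w => ?_⟩
  change spinalFun m ω b 0 (y :: w) = _
  by_cases h1 : y = qtop m
  · have h2 : y ≠ qone m := fun h2 => qone_ne_qtop m (h2.symm.trans h1)
    simp only [spinalFun, h1, if_true, spinalFun_succ]
    simp only [← h1, if_neg h2, mul_one]
    rfl
  · by_cases h2 : y = qone m
    · simp only [spinalFun, h2, qone_ne_qtop, if_true, if_false, one_mul]
      cases w <;> rfl
    · simp [spinalFun, h1, h2]

/-- If the first-level action of `g` is trivial and the sections have exponent dividing `M`,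
then so does `g`. -/
theorem pow_eq_one {M : ℕ} (hg : HasSections g 1 h) (hM : ∀ y, h y ^ M = 1) : g ^ M = 1 := by
  have key : ∀ n, HasSections (g ^ n) 1 fun y => h y ^ n := by
    intro n
    induction n with
    | zero => simpa using one
    | succ n ih => simpa [pow_succ] using ih.mul hg
  ext1 w
  cases w with
  | nil => simpa using (key M).nil
  | cons y w => simpa [hM] using (key M).cons y w

end HasSections

section Weights

/-- The weight of a nontrivial `B`-letter whose first trivial image has (0-based) index `t`. -/
def indexWeight (η : ℝ) (r t : ℕ) : ℝ := η ^ r + η ^ (r - (t + 1)) - 1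

/-- The (0-based) index of the first homomorphism of the sequence killing `b`. -/
def firstTrivial {m : ℕ} (ω : ℕ → GB →* Equiv.Perm (Fin (m + 2))) (b : GB) : ℕ :=
  sInf {j | ω j b = 1}

open scoped Classical in
/-- The weight of an `A`-letter, the trivial letter having weight zero. -/
def rootWeight {m : ℕ} (η : ℝ) (r : ℕ) (a : Equiv.Perm (Fin (m + 2))) : ℝ :=
  if a = 1 then 0 else 1 - η ^ r

open scoped Classical in
/-- The weight of a `B`-letter, the trivial letter having weight zero. -/
def spinalWeight {m : ℕ} (η : ℝ) (r : ℕ) (ω : ℕ → GB →* Equiv.Perm (Fin (m + 2))) (b : GB) : ℝ :=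
  if b = 1 then 0 else indexWeight η r (firstTrivial ω b)

variable {m r : ℕ} {η : ℝ} {ω : ℕ → GB →* Equiv.Perm (Fin (m + 2))}

theorem rootWeight_one : rootWeight η r (1 : Equiv.Perm (Fin (m + 2))) = 0 := by
  simp [rootWeight]

theorem spinalWeight_one : spinalWeight η r ω 1 = 0 := by
  simp [spinalWeight]

theorem rootWeight_nonneg (h0 : 0 < η) (h1 : η < 1) (a : Equiv.Perm (Fin (m + 2))) :
    0 ≤ rootWeight η r a := by
  have := pow_le_one₀ (n := r) h0.le h1.le
  rw [rootWeight]
  split_ifs <;> linarith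

theorem rootWeight_le_one (h0 : 0 < η) (a : Equiv.Perm (Fin (m + 2))) :
    rootWeight η r a ≤ 1 := by
  have := pow_pos h0 r
  rw [rootWeight]
  split_ifs <;> linarith

theorem rootWeight_mul_le (h0 : 0 < η) (h1 : η < 1) (a a' : Equiv.Perm (Fin (m + 2))) :
    rootWeight η r (a * a') ≤ rootWeight η r a + rootWeight η r a' := by
  have := pow_le_one₀ (n := r) h0.le h1.le
  by_cases ha : a = 1
  · simp [ha, rootWeight_one]
  by_cases ha' : a' = 1
  · simp [ha', rootWeight_one]
  simp only [rootWeight, ha, ha', if_false]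
  split_ifs <;> linarith

theorem indexWeight_mono (h0 : 0 < η) (h1 : η < 1) : Monotone (indexWeight η r) := by
  intro i j hij
  have : η ^ (r - (i + 1)) ≤ η ^ (r - (j + 1)) :=
    pow_le_pow_of_le_one h0.le h1.le (by omega)
  unfold indexWeight
  linarith

theorem indexWeight_le (h0 : 0 < η) (h1 : η < 1) (t : ℕ) : indexWeight η r t ≤ η ^ r := by
  have := pow_le_one₀ (n := r - (t + 1)) h0.le h1.le
  unfold indexWeight
  linarith

theorem indexWeight_nonneg (h0 : 0 < η) (h1 : η < 1)
    (hroot : η ^ r + η ^ (r - 1) + η ^ (r - 2) = 2) (t : ℕ) : 0 ≤ indexWeight η r t := by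
  refine le_trans ?_ (indexWeight_mono h0 h1 (Nat.zero_le t))
  have := pow_le_one₀ (n := r - 2) h0.le h1.le
  simp only [indexWeight, zero_add]
  linarith

theorem le_indexWeight_add (h0 : 0 < η) (h1 : η < 1)
    (hroot : η ^ r + η ^ (r - 1) + η ^ (r - 2) = 2) {i j : ℕ} (hij : i < j) :
    η ^ r ≤ indexWeight η r i + indexWeight η r j := by
  have hi := indexWeight_mono (r := r) h0 h1 (Nat.zero_le i)
  have hj := indexWeight_mono (r := r) h0 h1 (show 1 ≤ j by omega)
  simp only [indexWeight, zero_add, Nat.reduceAdd] at *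
  linarith

theorem spinalWeight_nonneg (h0 : 0 < η) (h1 : η < 1)
    (hroot : η ^ r + η ^ (r - 1) + η ^ (r - 2) = 2) (b : GB) : 0 ≤ spinalWeight η r ω b := by
  rw [spinalWeight]
  split_ifs
  · exact le_rfl
  · exact indexWeight_nonneg h0 h1 hroot _

theorem spinalWeight_le (h0 : 0 < η) (h1 : η < 1) (b : GB) : spinalWeight η r ω b ≤ η ^ r := by
  rw [spinalWeight]
  split_ifs
  · positivity
  · exact indexWeight_le h0 h1 _

theorem apply_firstTrivial {b : GB} (hb : ∃ j, ω j b = 1) : ω (firstTrivial ω b) b = 1 :=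
  Nat.sInf_mem hb

theorem firstTrivial_le {b : GB} {j : ℕ} (hj : ω j b = 1) : firstTrivial ω b ≤ j :=
  Nat.sInf_le hj

theorem spinalWeight_mul_le (h0 : 0 < η) (h1 : η < 1)
    (hroot : η ^ r + η ^ (r - 1) + η ^ (r - 2) = 2)
    (hω : ∀ b : GB, ∃ j, ω j b = 1) (b c : GB) :
    spinalWeight η r ω (b * c) ≤ spinalWeight η r ω b + spinalWeight η r ω c := by
  by_cases hb : b = 1
  · simp [hb, spinalWeight_one]
  by_cases hc : c = 1
  · simp [hc, spinalWeight_one]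
  rcases lt_trichotomy (firstTrivial ω b) (firstTrivial ω c) with h | h | h
  · refine (spinalWeight_le h0 h1 _).trans ?_
    simpa only [spinalWeight, hb, hc, if_false] using le_indexWeight_add h0 h1 hroot h
  · by_cases hbc : b * c = 1
    · rw [hbc, spinalWeight_one]
      exact add_nonneg (spinalWeight_nonneg h0 h1 hroot _) (spinalWeight_nonneg h0 h1 hroot _)
    have hle : firstTrivial ω (b * c) ≤ firstTrivial ω b := by
      refine firstTrivial_le ?_
      rw [map_mul, apply_firstTrivial (hω b), h, apply_firstTrivial (hω c), one_mul]
    have := indexWeight_mono (r := r) h0 h1 hle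
    have := spinalWeight_nonneg (ω := ω) h0 h1 hroot c
    simp only [spinalWeight, hb, hbc, if_false] at *
    linarith
  · refine (spinalWeight_le h0 h1 _).trans ?_
    rw [add_comm]
    simpa only [spinalWeight, hb, hc, if_false] using le_indexWeight_add h0 h1 hroot h

theorem firstTrivial_eq_succ {b : GB} (hb : ∃ j, ω j b = 1) (h : ω 0 b ≠ 1) :
    firstTrivial ω b = firstTrivial (fun n => ω (n + 1)) b + 1 := by
  have hspec := apply_firstTrivial hb
  have hpos : firstTrivial ω b ≠ 0 := fun h' => h (h' ▸ hspec)
  obtain ⟨t, ht⟩ := Nat.exists_eq_succ_of_ne_zero hpos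
  rw [ht] at hspec
  have h₁ : firstTrivial (fun n => ω (n + 1)) b ≤ t := firstTrivial_le hspec
  have h₂ : firstTrivial ω b ≤ firstTrivial (fun n => ω (n + 1)) b + 1 :=
    firstTrivial_le (apply_firstTrivial (ω := fun n => ω (n + 1)) ⟨t, hspec⟩)
  omega

/-- The letters of the first-level sections produced by a `B`-letter weigh at most `η` times
that letter together with one `A`-letter. -/
theorem spinalWeight_shift_add_le (h0 : 0 < η) (h1 : η < 1) {b : GB}
    (hω : ∃ j < r, ω j b = 1) (hb : b ≠ 1) :
    spinalWeight η r (fun n => ω (n + 1)) b + rootWeight η r (ω 0 b) ≤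
      η * (1 - η ^ r + spinalWeight η r ω b) := by
  obtain ⟨j, hjr, hj⟩ := hω
  by_cases h : ω 0 b = 1
  · have ht : firstTrivial ω b = 0 := Nat.le_zero.mp (firstTrivial_le h)
    have hle := spinalWeight_le (r := r) (ω := fun n => ω (n + 1)) h0 h1 b
    have hpow : η * η ^ (r - 1) = η ^ r := mul_pow_sub_one (by omega) η
    simp only [h, rootWeight_one, spinalWeight, hb, ht, if_false, indexWeight, zero_add] at *
    linarith
  · have ht := firstTrivial_eq_succ ⟨j, hj⟩ h
    have hle := firstTrivial_le hj
    have hpow : η * η ^ (r - (firstTrivial (fun n => ω (n + 1)) b + 1 + 1)) =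
        η ^ (r - (firstTrivial (fun n => ω (n + 1)) b + 1)) := by
      rw [← pow_succ']
      congr 1
      omega
    simp only [rootWeight, h, spinalWeight, hb, ht, if_false, indexWeight]
    linarith

end Weights

section Words

variable {m r : ℕ} {η : ℝ} {ω : ℕ → GB →* Equiv.Perm (Fin (m + 2))}

/-- The automorphism represented by an alternating word, given as a list of pairs of an
`A`-letter and a `B`-letter. -/
def pairEval (ω : ℕ → GB →* Equiv.Perm (Fin (m + 2)))
    (L : List (Equiv.Perm (Fin (m + 2)) × GB)) : Equiv.Perm (List (Fin (m + 2))) :=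
  (L.map fun p => rootHom m p.1 * spinalHom m ω p.2).prod

/-- The weight of an alternating word. -/
def pairWeight (η : ℝ) (r : ℕ) (ω : ℕ → GB →* Equiv.Perm (Fin (m + 2)))
    (L : List (Equiv.Perm (Fin (m + 2)) × GB)) : ℝ :=
  (L.map fun p => rootWeight η r p.1 + spinalWeight η r ω p.2).sum

theorem pairEval_append (L L' : List (Equiv.Perm (Fin (m + 2)) × GB)) :
    pairEval ω (L ++ L') = pairEval ω L * pairEval ω L' := by
  simp [pairEval]

theorem pairEval_cons (p : Equiv.Perm (Fin (m + 2)) × GB)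
    (L : List (Equiv.Perm (Fin (m + 2)) × GB)) :
    pairEval ω (p :: L) = rootHom m p.1 * spinalHom m ω p.2 * pairEval ω L := by
  simp [pairEval]

theorem pairWeight_append (L L' : List (Equiv.Perm (Fin (m + 2)) × GB)) :
    pairWeight η r ω (L ++ L') = pairWeight η r ω L + pairWeight η r ω L' := by
  simp [pairWeight]

theorem pairWeight_cons (p : Equiv.Perm (Fin (m + 2)) × GB)
    (L : List (Equiv.Perm (Fin (m + 2)) × GB)) :
    pairWeight η r ω (p :: L) =
      rootWeight η r p.1 + spinalWeight η r ω p.2 + pairWeight η r ω L := by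
  simp [pairWeight]

theorem isConj_mul_comm {G : Type*} [Group G] (x y : G) : IsConj (x * y) (y * x) :=
  isConj_iff.mpr ⟨y, by group⟩

theorem pow_eq_one_of_isConj {G : Type*} [Group G] {x y : G} (h : IsConj x y) {n : ℕ}
    (hy : y ^ n = 1) : x ^ n = 1 := by
  obtain ⟨c, rfl⟩ := isConj_iff.mp h.symm
  rw [conj_pow, hy, mul_one, mul_inv_cancel]

/-- Every element represented by an alternating word is conjugate either to a single letter or
to an element represented by a nonempty alternating word, without trivial letters, that is not
heavier. -/
theorem exists_isConj_reduced (h0 : 0 < η) (h1 : η < 1)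
    (hroot : η ^ r + η ^ (r - 1) + η ^ (r - 2) = 2) (hω : ∀ b : GB, ∃ j, ω j b = 1)
    {GA : Subgroup (Equiv.Perm (Fin (m + 2)))} (L : List (Equiv.Perm (Fin (m + 2)) × GB))
    (hL : ∀ p ∈ L, p.1 ∈ GA) :
    (∃ a ∈ GA, IsConj (pairEval ω L) (rootHom m a)) ∨
    (∃ b, IsConj (pairEval ω L) (spinalHom m ω b)) ∨
    ∃ L' : List (Equiv.Perm (Fin (m + 2)) × GB), L' ≠ [] ∧
      (∀ p ∈ L', p.1 ∈ GA ∧ p.1 ≠ 1 ∧ p.2 ≠ 1) ∧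
      IsConj (pairEval ω L) (pairEval ω L') ∧ pairWeight η r ω L' ≤ pairWeight η r ω L := by
  induction hn : L.length generalizing L with
  | zero =>
    rw [List.length_eq_zero_iff] at hn
    subst hn
    exact .inl ⟨1, GA.one_mem, by simp [pairEval]⟩
  | succ n ih =>
    by_cases hgood : ∀ p ∈ L, p.1 ≠ 1 ∧ p.2 ≠ 1
    · refine .inr (.inr ⟨L, ?_, fun p hp => ⟨hL p hp, hgood p hp⟩, IsConj.refl _, le_rfl⟩)
      rintro rfl
      simp at hn
    suffices H : (∃ a ∈ GA, IsConj (pairEval ω L) (rootHom m a)) ∨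
        (∃ b, IsConj (pairEval ω L) (spinalHom m ω b)) ∨
        ∃ L₁ : List (Equiv.Perm (Fin (m + 2)) × GB), (∀ p ∈ L₁, p.1 ∈ GA) ∧ L₁.length = n ∧
          IsConj (pairEval ω L) (pairEval ω L₁) ∧
          pairWeight η r ω L₁ ≤ pairWeight η r ω L by
      rcases H with H | H | ⟨L₁, hL₁, hlen, hconj, hw⟩
      · exact .inl H
      · exact .inr (.inl H)
      rcases ih L₁ hL₁ hlen with ⟨a, ha, h⟩ | ⟨b, h⟩ | ⟨L', hne, hL', h, hw'⟩
      · exact .inl ⟨a, ha, hconj.trans h⟩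
      · exact .inr (.inl ⟨b, hconj.trans h⟩)
      · exact .inr (.inr ⟨L', hne, hL', hconj.trans h, hw'.trans hw⟩)
    push Not at hgood
    obtain ⟨⟨a, b⟩, hp, hab⟩ := hgood
    obtain ⟨s, t, rfl⟩ := List.append_of_mem hp
    have hconj : IsConj (pairEval ω (s ++ (a, b) :: t)) (pairEval ω ((a, b) :: (t ++ s))) := by
      rw [← List.cons_append, pairEval_append, pairEval_append]
      exact isConj_mul_comm _ _
    have hweight : pairWeight η r ω (s ++ (a, b) :: t) =
        rootWeight η r a + spinalWeight η r ω b + pairWeight η r ω (t ++ s) := by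
      rw [pairWeight_append, pairWeight_cons, pairWeight_append]
      ring
    have hmem : ∀ p ∈ t ++ s, p.1 ∈ GA := fun p hp => hL p (by
      simp only [List.mem_append, List.mem_cons] at hp ⊢
      tauto)
    have haGA : a ∈ GA := hL _ hp
    have hlen : (t ++ s).length = n := by
      simp only [List.length_append, List.length_cons] at hn ⊢
      omega
    generalize t ++ s = u at *
    by_cases ha : a = 1
    · subst ha
      rcases List.eq_nil_or_concat u with rfl | ⟨v, ⟨a', b'⟩, rfl⟩
      · exact .inr (.inl ⟨b, by simpa [pairEval] using hconj⟩)
      · refine .inr (.inr ⟨v ++ [(a', b' * b)], ?_, ?_, hconj.trans ?_, ?_⟩)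
        · intro p hp
          simp only [List.mem_append, List.mem_singleton] at hp
          rcases hp with hp | rfl
          · exact hmem p (by simp [hp])
          · exact hmem (a', b') (by simp)
        · simpa using hlen
        · have := isConj_mul_comm (spinalHom m ω b) (pairEval ω (v ++ [(a', b')]))
          simpa [pairEval, mul_assoc] using this
        · rw [hweight]
          have := spinalWeight_mul_le h0 h1 hroot hω b' b
          simp only [List.concat_eq_append, pairWeight_append, pairWeight_cons, rootWeight_one]
          linarith
    · have hb : b = 1 := hab ha
      subst hb
      rcases u with _ | ⟨⟨a', b'⟩, v⟩
      · exact .inl ⟨a, haGA, by simpa [pairEval] using hconj⟩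
      · refine .inr (.inr ⟨(a * a', b') :: v, ?_, ?_, hconj.trans ?_, ?_⟩)
        · intro p hp
          rcases List.mem_cons.mp hp with rfl | hp
          · exact GA.mul_mem haGA (hmem (a', b') (by simp))
          · exact hmem p (by simp [hp])
        · simpa using hlen
        · rw [pairEval_cons, pairEval_cons, pairEval_cons, map_one, mul_one, map_mul]
          simp only [mul_assoc]
          exact IsConj.refl _
        · rw [hweight]
          have := rootWeight_mul_le (r := r) h0 h1 a a'
          simp only [pairWeight_cons, spinalWeight_one]
          linarith

/-- `g` is represented by an alternating word of weight at most `x`. -/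
def HasWeightLE (GA : Subgroup (Equiv.Perm (Fin (m + 2)))) (η : ℝ) (r : ℕ)
    (ω : ℕ → GB →* Equiv.Perm (Fin (m + 2))) (g : Equiv.Perm (List (Fin (m + 2)))) (x : ℝ) :
    Prop :=
  ∃ L : List (Equiv.Perm (Fin (m + 2)) × GB),
    (∀ p ∈ L, p.1 ∈ GA) ∧ pairEval ω L = g ∧ pairWeight η r ω L ≤ x

variable {GA : Subgroup (Equiv.Perm (Fin (m + 2)))} {g h : Equiv.Perm (List (Fin (m + 2)))}
  {x y : ℝ}

theorem HasWeightLE.one (hx : 0 ≤ x) : HasWeightLE GA η r ω 1 x :=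
  ⟨[], by simp, by simp [pairEval], by simpa [pairWeight] using hx⟩

theorem HasWeightLE.mul (hg : HasWeightLE GA η r ω g x) (hh : HasWeightLE GA η r ω h y) :
    HasWeightLE GA η r ω (g * h) (x + y) := by
  obtain ⟨L, hL, rfl, hx⟩ := hg
  obtain ⟨L', hL', rfl, hy⟩ := hh
  refine ⟨L ++ L', ?_, pairEval_append L L', ?_⟩
  · intro p hp
    rcases List.mem_append.mp hp with hp | hp
    exacts [hL p hp, hL' p hp]
  · rw [pairWeight_append]
    linarith

theorem HasWeightLE.mono (hg : HasWeightLE GA η r ω g x) (hxy : x ≤ y) :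
    HasWeightLE GA η r ω g y := by
  obtain ⟨L, hL, he, hx⟩ := hg
  exact ⟨L, hL, he, hx.trans hxy⟩

theorem hasWeightLE_rootHom {a : Equiv.Perm (Fin (m + 2))} (ha : a ∈ GA) :
    HasWeightLE GA η r ω (rootHom m a) (rootWeight η r a) :=
  ⟨[(a, 1)], by simpa using ha, by simp [pairEval], by simp [pairWeight, spinalWeight_one]⟩

theorem hasWeightLE_spinalHom (b : GB) :
    HasWeightLE GA η r ω (spinalHom m ω b) (spinalWeight η r ω b) :=
  ⟨[(1, b)], by simp, by simp [pairEval], by simp [pairWeight, rootWeight_one]⟩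

/-- The first-level sections of an alternating word without trivial letters have total weight at
most `η` times the weight of the word. -/
theorem exists_sections (h0 : 0 < η) (h1 : η < 1)
    (hroot : η ^ r + η ^ (r - 1) + η ^ (r - 2) = 2) (hGA : ∀ b, ω 0 b ∈ GA)
    (hω : ∀ b : GB, ∃ j < r, ω j b = 1) (L : List (Equiv.Perm (Fin (m + 2)) × GB))
    (hL : ∀ p ∈ L, p.1 ∈ GA ∧ p.1 ≠ 1 ∧ p.2 ≠ 1) :
    ∃ π ∈ GA, ∃ (h : Fin (m + 2) → Equiv.Perm (List (Fin (m + 2)))) (wt : Fin (m + 2) → ℝ),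
      HasSections (pairEval ω L) π h ∧
      (∀ y, 0 ≤ wt y ∧ HasWeightLE GA η r (fun n => ω (n + 1)) (h y) (wt y)) ∧
      ∑ y, wt y ≤ η * pairWeight η r ω L := by
  induction L with
  | nil =>
    exact ⟨1, GA.one_mem, fun _ => 1, fun _ => 0, by simpa [pairEval] using HasSections.one,
      fun _ => ⟨le_rfl, HasWeightLE.one le_rfl⟩, by simp [pairWeight]⟩
  | cons p L ih =>
    obtain ⟨a, b⟩ := p
    obtain ⟨π, hπ, h, wt, hsec, hwt, hsum⟩ := ih fun p hp => hL p (List.mem_cons_of_mem _ hp)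
    obtain ⟨ha, ha1, hb1⟩ := hL (a, b) (by simp)
    let wt' : Fin (m + 2) → ℝ := fun y =>
      (if y = qtop m then spinalWeight η r (fun n => ω (n + 1)) b else 0) +
        (if y = qone m then rootWeight η r (ω 0 b) else 0)
    have hsec' := ((HasSections.rootHom a).mul (HasSections.spinalHom ω b)).mul hsec
    rw [← pairEval_cons (a, b)] at hsec'
    refine ⟨a * 1 * π, GA.mul_mem (by simpa using ha) hπ, _, fun y => wt' (π y) + wt y, hsec',
      ?_, ?_⟩
    · intro y
      have hw := hwt y
      refine ⟨add_nonneg (add_nonneg ?_ ?_) hw.1, HasWeightLE.mul ?_ hw.2⟩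
      · split_ifs
        exacts [spinalWeight_nonneg h0 h1 hroot b, le_rfl]
      · split_ifs
        exacts [rootWeight_nonneg h0 h1 _, le_rfl]
      · rw [one_mul]
        refine HasWeightLE.mul ?_ ?_
        · split_ifs
          exacts [hasWeightLE_spinalHom b, HasWeightLE.one le_rfl]
        · split_ifs
          exacts [hasWeightLE_rootHom (hGA b), HasWeightLE.one le_rfl]
    · have hle := spinalWeight_shift_add_le h0 h1 (hω b) hb1
      rw [Finset.sum_add_distrib, Equiv.sum_comp π wt', pairWeight_cons]
      simp only [wt', Finset.sum_add_distrib, Finset.sum_ite_eq', Finset.mem_univ, if_true]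
      have harw : rootWeight η r a = 1 - η ^ r := if_neg ha1
      rw [harw]
      linarith

theorem HasSections.exists_pow {π : Equiv.Perm (Fin (m + 2))}
    {h : Fin (m + 2) → Equiv.Perm (List (Fin (m + 2)))} {wt : Fin (m + 2) → ℝ}
    (hg : HasSections g π h) (hwt : ∀ y, HasWeightLE GA η r ω (h y) (wt y)) (n : ℕ) :
    ∃ h', HasSections (g ^ n) (π ^ n) h' ∧
      ∀ y, HasWeightLE GA η r ω (h' y) (∑ j ∈ Finset.range n, wt ((π ^ j) y)) := by
  induction n with
  | zero =>
    exact ⟨fun _ => 1, by simpa using HasSections.one, fun _ => HasWeightLE.one (by simp)⟩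
  | succ n ih =>
    obtain ⟨h', hg', hwt'⟩ := ih
    refine ⟨fun y => h ((π ^ n) y) * h' y, ?_, fun y => ?_⟩
    · rw [pow_succ', pow_succ']
      exact hg.mul hg'
    · rw [Finset.sum_range_succ, add_comm (Finset.sum _ _)]
      exact (hwt _).mul (hwt' y)

/-- If all cycles of a permutation have the same length, then this length divides the number of
points. -/
theorem minimalPeriod_dvd_card {α : Type*} [Fintype α] (π : Equiv.Perm α)
    (hreg : ∀ y z, Function.minimalPeriod (⇑π) y = Function.minimalPeriod (⇑π) z) (y : α) :
    Function.minimalPeriod (⇑π) y ∣ Fintype.card α := by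
  classical
  rw [Fintype.card_congr (MulAction.selfEquivSigmaOrbits (Subgroup.zpowers π) α),
    Fintype.card_sigma]
  refine Finset.dvd_sum fun o _ => ?_
  rw [hreg y o.out]
  exact dvd_of_eq (MulAction.minimalPeriod_eq_card (a := π) (b := o.out))

/-- An element of weight at most `x` either has order dividing `|G_A| * |G_B|`, or is conjugate
to an element represented by a nonempty alternating word, without trivial letters, of weight at
most `x`. -/
theorem HasWeightLE.pow_card_eq_one_or_exists (h0 : 0 < η) (h1 : η < 1)
    (hroot : η ^ r + η ^ (r - 1) + η ^ (r - 2) = 2) (hω : ∀ b : GB, ∃ j, ω j b = 1)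
    (hg : HasWeightLE GA η r ω g x) :
    g ^ (Nat.card GA * Nat.card GB) = 1 ∨
    ∃ L : List (Equiv.Perm (Fin (m + 2)) × GB), L ≠ [] ∧
      (∀ p ∈ L, p.1 ∈ GA ∧ p.1 ≠ 1 ∧ p.2 ≠ 1) ∧
      IsConj g (pairEval ω L) ∧ pairWeight η r ω L ≤ x := by
  obtain ⟨L, hL, rfl, hLx⟩ := hg
  rcases exists_isConj_reduced h0 h1 hroot hω L hL with
    ⟨a, ha, hc⟩ | ⟨b, hc⟩ | ⟨L', hne, hL', hc, hw⟩
  · have : a ^ Nat.card GA = 1 :=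
      congrArg Subtype.val (pow_card_eq_one' (x := (⟨a, ha⟩ : GA)))
    refine .inl (pow_eq_one_of_isConj hc ?_)
    rw [← map_pow, pow_mul, this, one_pow, map_one]
  · refine .inl (pow_eq_one_of_isConj hc ?_)
    rw [← map_pow, mul_comm, pow_mul, pow_card_eq_one', one_pow, map_one]
  · exact .inr ⟨L', hne, hL', hc, hw.trans hLx⟩

theorem le_pairWeight (h0 : 0 < η) (h1 : η < 1)
    (hroot : η ^ r + η ^ (r - 1) + η ^ (r - 2) = 2) {L : List (Equiv.Perm (Fin (m + 2)) × GB)}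
    (hne : L ≠ []) (hL : ∀ p ∈ L, p.1 ≠ 1 ∧ p.2 ≠ 1) : η ^ (r - 1) ≤ pairWeight η r ω L := by
  obtain ⟨p, L, rfl⟩ := List.exists_cons_of_ne_nil hne
  obtain ⟨hp1, hp2⟩ := hL p (by simp)
  have hnn : 0 ≤ pairWeight η r ω L := List.sum_nonneg fun z hz => by
    obtain ⟨p, -, rfl⟩ := List.mem_map.mp hz
    exact add_nonneg (rootWeight_nonneg h0 h1 _) (spinalWeight_nonneg h0 h1 hroot _)
  have hmono := indexWeight_mono (r := r) h0 h1 (Nat.zero_le (firstTrivial ω p.2))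
  rw [indexWeight, zero_add] at hmono
  rw [pairWeight_cons, rootWeight, if_neg hp1, spinalWeight, if_neg hp2]
  linarith

/-- The power of a reduced alternating word by the cycle length of its first-level action fixes
the first level, and its sections there weigh at most `η` times the word. -/
theorem exists_pow_hasSections (h0 : 0 < η) (h1 : η < 1)
    (hroot : η ^ r + η ^ (r - 1) + η ^ (r - 2) = 2)
    (hreg : ∀ a ∈ GA, ∀ y z : Fin (m + 2),
      Function.minimalPeriod (⇑a) y = Function.minimalPeriod (⇑a) z)
    (hGA : ∀ b, ω 0 b ∈ GA) (hω : ∀ b : GB, ∃ j < r, ω j b = 1)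
    (L : List (Equiv.Perm (Fin (m + 2)) × GB))
    (hL : ∀ p ∈ L, p.1 ∈ GA ∧ p.1 ≠ 1 ∧ p.2 ≠ 1) :
    ∃ s, s ∣ m + 2 ∧ ∃ h, HasSections (pairEval ω L ^ s) 1 h ∧
      ∀ y, HasWeightLE GA η r (fun n => ω (n + 1)) (h y) (η * pairWeight η r ω L) := by
  obtain ⟨π, hπ, h, wt, hsec, hwt, hsum⟩ := exists_sections h0 h1 hroot hGA hω L hL
  obtain ⟨h', hsec', hwt'⟩ := hsec.exists_pow (fun y => (hwt y).2) (Function.minimalPeriod (⇑π) 0)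
  have hπs : π ^ Function.minimalPeriod (⇑π) 0 = 1 := by
    ext1 y
    rw [hreg π hπ 0 y, Equiv.Perm.coe_pow]
    exact Function.isPeriodicPt_minimalPeriod _ _
  rw [hπs] at hsec'
  refine ⟨_, ?_, h', hsec', fun y => (hwt' y).mono ?_⟩
  · simpa only [Fintype.card_fin] using minimalPeriod_dvd_card π (hreg π hπ) 0
  · have hinj : Set.InjOn (fun j => (π ^ j) y)
        (Finset.range (Function.minimalPeriod (⇑π) 0) : Set ℕ) := by
      intro i hi j hj hij
      rw [hreg π hπ 0 y, Finset.coe_range] at hi hj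
      simp only [Equiv.Perm.coe_pow] at hij
      exact (Function.iterate_eq_iterate_iff_of_lt_minimalPeriod hi hj).mp hij
    rw [← Finset.sum_image (f := wt) hinj]
    exact (Finset.sum_le_univ_sum_of_nonneg fun z => (hwt z).1).trans hsum

/-- An element of weight `x < η ^ (r - 1 - k)` has order dividing
`q ^ k * |G_A| * |G_B|`. -/
theorem HasWeightLE.pow_eq_one (h0 : 0 < η) (h1 : η < 1)
    (hroot : η ^ r + η ^ (r - 1) + η ^ (r - 2) = 2)
    (hreg : ∀ a ∈ GA, ∀ y z : Fin (m + 2),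
      Function.minimalPeriod (⇑a) y = Function.minimalPeriod (⇑a) z)
    (hGA : ∀ n b, ω n b ∈ GA)
    (hhom : ∀ i : ℕ, ∀ b : GB, ∃ j, i ≤ j ∧ j < i + r ∧ ω j b = 1)
    (k : ℕ) (hg : HasWeightLE GA η r ω g x) (hx : x * η ^ k < η ^ (r - 1)) :
    g ^ ((m + 2) ^ k * (Nat.card GA * Nat.card GB)) = 1 := by
  induction k generalizing ω g x with
  | zero =>
    have hω : ∀ b : GB, ∃ j, ω j b = 1 := fun b => (hhom 0 b).imp fun _ h => h.2.2
    rcases hg.pow_card_eq_one_or_exists h0 h1 hroot hω with h | ⟨L, hne, hL, -, hw⟩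
    · rwa [pow_zero, one_mul]
    · have := le_pairWeight (ω := ω) h0 h1 hroot hne fun p hp => (hL p hp).2
      rw [pow_zero, mul_one] at hx
      linarith
  | succ k ih =>
    have hω : ∀ b : GB, ∃ j < r, ω j b = 1 := fun b => by
      obtain ⟨j, -, hj, hjb⟩ := hhom 0 b
      exact ⟨j, by omega, hjb⟩
    rcases hg.pow_card_eq_one_or_exists h0 h1 hroot (fun b => (hω b).imp fun _ h => h.2) with
      h | ⟨L, -, hL, hc, hw⟩
    · rw [mul_comm, pow_mul, h, one_pow]
    obtain ⟨s, hs, h, hsec, hwt⟩ := exists_pow_hasSections h0 h1 hroot hreg (hGA 0) hω L hL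
    have hM : ∀ y, h y ^ ((m + 2) ^ k * (Nat.card GA * Nat.card GB)) = 1 := fun y =>
      ih (fun n b => hGA (n + 1) b)
        (fun i b => by
          obtain ⟨j, hij, hjr, hj⟩ := hhom (i + 1) b
          refine ⟨j - 1, by omega, by omega, ?_⟩
          rwa [Nat.sub_add_cancel (by omega)])
        ((hwt y).mono (mul_le_mul_of_nonneg_left hw h0.le))
        (by rw [pow_succ'] at hx; linarith)
    have key := hsec.pow_eq_one hM
    rw [← pow_mul] at key
    refine pow_eq_one_of_isConj hc (orderOf_dvd_iff_pow_eq_one.mp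
      ((orderOf_dvd_of_pow_eq_one key).trans ?_))
    rw [pow_succ', mul_assoc]
    exact Nat.mul_dvd_mul_right hs _

end Words

section WordLength

theorem inv_mem_genSet {m : ℕ} {GA : Subgroup (Equiv.Perm (Fin (m + 2)))}
    {ω : ℕ → GB →* Equiv.Perm (Fin (m + 2))} {g : Equiv.Perm (List (Fin (m + 2)))}
    (hg : g ∈ genSet m GA ω) : g⁻¹ ∈ genSet m GA ω := by
  obtain ⟨h, hne⟩ := hg
  refine ⟨?_, fun h' => hne (inv_eq_one.mp h')⟩
  rcases h with ⟨a, ha, rfl⟩ | ⟨b, rfl⟩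
  · exact .inl ⟨a⁻¹, GA.inv_mem ha, map_inv (rootHom m) a⟩
  · exact .inr ⟨b⁻¹, map_inv (spinalHom m ω) b⟩

theorem exists_list_length_eq_wordLength {m : ℕ} {GA : Subgroup (Equiv.Perm (Fin (m + 2)))}
    {ω : ℕ → GB →* Equiv.Perm (Fin (m + 2))} {g : Equiv.Perm (List (Fin (m + 2)))}
    (hg : g ∈ spinalGroup m GA ω) :
    ∃ l : List (Equiv.Perm (List (Fin (m + 2)))), l.length = wordLength (genSet m GA ω) g ∧
      (∀ x ∈ l, x ∈ genSet m GA ω) ∧ l.prod = g := by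
  rw [spinalGroup, ← Subgroup.mem_toSubmonoid, Subgroup.closure_toSubmonoid] at hg
  obtain ⟨l, hl, hprod⟩ := Submonoid.exists_list_of_mem_closure hg
  refine Nat.sInf_mem (s := {n | ∃ l : List (Equiv.Perm (List (Fin (m + 2)))), l.length = n ∧
    (∀ x ∈ l, x ∈ genSet m GA ω) ∧ l.prod = g}) ⟨_, l, rfl, fun x hx => ?_, hprod⟩
  rcases hl x hx with h | h
  · exact h
  · simpa using inv_mem_genSet (Set.mem_inv.mp h)

theorem hasWeightLE_wordLength {m r : ℕ} {η : ℝ} {GA : Subgroup (Equiv.Perm (Fin (m + 2)))}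
    {ω : ℕ → GB →* Equiv.Perm (Fin (m + 2))} {g : Equiv.Perm (List (Fin (m + 2)))}
    (h0 : 0 < η) (h1 : η < 1) (hg : g ∈ spinalGroup m GA ω) :
    HasWeightLE GA η r ω g (wordLength (genSet m GA ω) g) := by
  obtain ⟨l, hlen, hl, rfl⟩ := exists_list_length_eq_wordLength hg
  rw [← hlen]
  clear hlen hg
  induction l with
  | nil => exact HasWeightLE.one (by simp)
  | cons x l ih =>
    have hx : HasWeightLE GA η r ω x 1 := by
      rcases (hl x (by simp)).1 with ⟨a, ha, rfl⟩ | ⟨b, rfl⟩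
      · exact (hasWeightLE_rootHom ha).mono (rootWeight_le_one h0 a)
      · exact (hasWeightLE_spinalHom b).mono
          ((spinalWeight_le h0 h1 b).trans (pow_le_one₀ h0.le h1.le))
    have := hx.mul (ih fun y hy => hl y (List.mem_cons_of_mem _ hy))
    simpa [add_comm] using this

end WordLength

theorem exists_pow_le_rpow_logb {η q D : ℝ} (h0 : 0 < η) (h1 : η < 1) (hq : 1 < q) (hD : 0 < D)
    {x y : ℝ} (hx : 0 < x) (hy : 0 < y) (hyx : y ≤ x) :
    ∃ k : ℕ, x * η ^ k < y ∧
      q ^ k * D ≤ ((q * D) ^ (Real.logb (1 / η) q)⁻¹ * (x / y)) ^ Real.logb (1 / η) q := by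
  have hβ : 1 < 1 / η := one_lt_one_div h0 h1
  have hβ0 : 0 < 1 / η := by positivity
  have he : 0 < Real.logb (1 / η) q := Real.logb_pos hβ hq
  have hlog : 0 ≤ Real.logb (1 / η) (x / y) :=
    Real.logb_nonneg hβ ((one_le_div hy).mpr hyx)
  refine ⟨⌊Real.logb (1 / η) (x / y)⌋₊ + 1, ?_, ?_⟩
  · have hlt := Nat.lt_floor_add_one (Real.logb (1 / η) (x / y))
    rw [Real.logb_lt_iff_lt_rpow hβ (by positivity), ← Nat.cast_succ, Real.rpow_natCast,
      one_div_pow, one_div, div_lt_iff₀ hy, inv_mul_eq_div, lt_div_iff₀ (by positivity)] at hlt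
    exact hlt
  · have hk : q ^ ⌊Real.logb (1 / η) (x / y)⌋₊ ≤ (x / y) ^ Real.logb (1 / η) q := by
      calc q ^ ⌊Real.logb (1 / η) (x / y)⌋₊
          ≤ q ^ Real.logb (1 / η) (x / y) := by
            rw [← Real.rpow_natCast]
            exact Real.rpow_le_rpow_of_exponent_le hq.le (Nat.floor_le hlog)
        _ = (x / y) ^ Real.logb (1 / η) q := by
            nth_rewrite 1 [← Real.rpow_logb hβ0 hβ.ne' (show 0 < q by linarith)]
            rw [← Real.rpow_mul hβ0.le, mul_comm, Real.rpow_mul hβ0.le,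
              Real.rpow_logb hβ0 hβ.ne' (by positivity)]
    rw [Real.mul_rpow (by positivity) (by positivity), Real.rpow_inv_rpow (by positivity) he.ne',
      pow_succ]
    nlinarith [mul_le_mul_of_nonneg_left hk (show 0 ≤ q * D by positivity)]

/-- Period η-Estimate: if the action of `G_A` is regular and `ω ∈ Ω̂` is `r`-homogeneous
(`r ≥ 3`), then `π_ω(n) ≾ n^{log_{1/η_r}(q)}`, where `η_r` is the unique root in `(0,1)`
of `x^r + x^{r-1} + x^{r-2} - 2`. -/
theorem spinalGroup_period_growth_eta (m : ℕ) (GA : Subgroup (Equiv.Perm (Fin (m + 2))))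
    {GB : Type*} [Group GB] [Finite GB] (ω : ℕ → GB →* Equiv.Perm (Fin (m + 2)))
    (hdata : SpinalData m GA ω)
    (hreg : ∀ a ∈ GA, ∀ y z : Fin (m + 2),
      Function.minimalPeriod (⇑a) y = Function.minimalPeriod (⇑a) z)
    (r : ℕ) (hr : 3 ≤ r)
    (hhom : ∀ i : ℕ, ∀ b : GB, ∃ j, i ≤ j ∧ j < i + r ∧ ω j b = 1)
    (η : ℝ) (hη0 : 0 < η) (hη1 : η < 1)
    (hroot : η ^ r + η ^ (r - 1) + η ^ (r - 2) = 2) :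
    ∃ C : ℝ, 0 < C ∧ ∀ n : ℕ, 1 ≤ n →
      (periodGrowth m GA ω n : ℝ) ≤ (C * n) ^ (Real.logb (1 / η) (m + 2)) := by
  have hK : 0 < Nat.card GA * Nat.card GB := Nat.mul_pos Nat.card_pos Nat.card_pos
  have hD : (0 : ℝ) < (Nat.card GA * Nat.card GB : ℕ) := Nat.cast_pos.mpr hK
  have hq : (1 : ℝ) < (m + 2 : ℝ) := by
    have : (0 : ℝ) ≤ m := Nat.cast_nonneg m
    linarith
  have hGA : ∀ n b, ω n b ∈ GA := fun n b => hdata.range_eq n ▸ ⟨b, rfl⟩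
  refine ⟨((m + 2 : ℝ) * (Nat.card GA * Nat.card GB : ℕ)) ^ (Real.logb (1 / η) (m + 2))⁻¹ /
    η ^ (r - 1), by positivity, fun n hn => ?_⟩
  have hn' : (1 : ℝ) ≤ n := Nat.one_le_cast.mpr hn
  obtain ⟨k, hk, hle⟩ := exists_pow_le_rpow_logb hη0 hη1 hq hD (x := n) (y := η ^ (r - 1))
    (by linarith) (by positivity) ((pow_le_one₀ hη0.le hη1.le).trans hn')
  rw [div_mul_eq_mul_div, mul_div_assoc]
  refine le_trans ?_ hle
  have hbound : periodGrowth m GA ω n ≤ (m + 2) ^ k * (Nat.card GA * Nat.card GB) := by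
    refine csSup_le' ?_
    rintro _ ⟨g, ⟨hg, hgn⟩, rfl⟩
    have hw : HasWeightLE GA η r ω g n :=
      (hasWeightLE_wordLength hη0 hη1 hg).mono (Nat.cast_le.mpr hgn)
    exact orderOf_le_of_pow_eq_one (by positivity)
      (hw.pow_eq_one hη0 hη1 hroot hreg hGA hhom k hk)
  exact_mod_cast hbound

end Spinal
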